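/- Let ω be a domain in ℝ² which is not n-hyperbolic (for some n ≥ 1). Then at least one of the following holds: (1) the closure of ω contains an affine line of ℝ²; (2) for every t ∈ ℝ there exists a sequence (x_k, y_k) in ω with x_k → +∞ and y_k → t; (3) for every t ∈ ℝ there exists a sequence (x_k, y_k) in ω with x_k → −∞ and y_k → t; (4) for every t ∈ ℝ there exists a sequence (x_k, y_k) in ω with y_k → +∞ and x_k → t; (5) for every t ∈ ℝ there exists a sequence (x_k, y_k) in ω with y_k → −∞ and x_k → t. -/

import Mathlib

open Filter Topology Metric

noncomputable section

/-- `ℝ^m` with the Euclidean structure. -/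
abbrev E (m : ℕ) := EuclideanSpace ℝ (Fin m)

/-- The Laplacian of `f` at `x`. -/
noncomputable def lap {m : ℕ} (f : E m → ℝ) (x : E m) : ℝ :=
  ∑ i, fderiv ℝ (fun y => fderiv ℝ f y (EuclideanSpace.single i 1)) x (EuclideanSpace.single i 1)

/-- `f` is harmonic on `U`: real-valued, `C²` with vanishing Laplacian. -/
def HarmOn {m : ℕ} (U : Set (E m)) (f : E m → ℝ) : Prop :=
  ContDiffOn ℝ 2 f U ∧ ∀ x ∈ U, lap f x = 0

/-- `f̃ x = |∇f(x)| / cosh (f x)`. -/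
noncomputable def tilde {m : ℕ} (f : E m → ℝ) (x : E m) : ℝ :=
  ‖gradient f x‖ / Real.cosh (f x)

/-- `S(x) = arctan (sinh x)`, extended to `[-∞,+∞]` by `S(±∞) = ±π/2`.  The distance on
`[-∞,+∞]` is `d(x,y) = |S x - S y|`. -/
noncomputable def SF : EReal → ℝ := fun x =>
  if x = ⊤ then Real.pi / 2 else if x = ⊥ then -(Real.pi / 2)
  else Real.arctan (Real.sinh x.toReal)

/-- Uniform convergence on every compact subset of `U`, with respect to the distance
`d(x,y) = |S x - S y|` on `[-∞,+∞]`. -/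
def TendstoCptsE {m : ℕ} (U : Set (E m)) (g : ℕ → E m → EReal) (G : E m → EReal) : Prop :=
  ∀ K ⊆ U, IsCompact K → ∀ ε > 0, ∃ N : ℕ, ∀ n ≥ N, ∀ x ∈ K, |SF (g n x) - SF (G x)| < ε

/-- A family `Fam` of harmonic functions on `U` is normal if every sequence in `Fam` has a
subsequence converging uniformly on compact subsets of `U` either to a harmonic function on
`U`, or to the constant `+∞`, or to the constant `-∞`. -/
def NormalFam {m : ℕ} (U : Set (E m)) (Fam : Set (E m → ℝ)) : Prop :=
  ∀ f : ℕ → E m → ℝ, (∀ n, f n ∈ Fam) →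
    ∃ φ : ℕ → ℕ, StrictMono φ ∧
      ((∃ g : E m → ℝ, HarmOn U g ∧
          TendstoCptsE U (fun k x => ((f (φ k) x : ℝ) : EReal)) (fun x => ((g x : ℝ) : EReal)))
       ∨ TendstoCptsE U (fun k x => ((f (φ k) x : ℝ) : EReal)) (fun _ => (⊤ : EReal))
       ∨ TendstoCptsE U (fun k x => ((f (φ k) x : ℝ) : EReal)) (fun _ => (⊥ : EReal)))

/-- The point `(x, y)` of `ℝ²`. -/
noncomputable def pt (x y : ℝ) : E 2 := (WithLp.equiv 2 (Fin 2 → ℝ)).symm ![x, y]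

/-- `V ⊆ ℝ²` is `n`-hyperbolic (w.r.t. harmonic maps): for every `a ∈ V` there are a
neighborhood `W` of `a` in `V` and `M > 0` such that every harmonic map `F` from the open
unit ball of `ℝⁿ` into `V` with `F 0 ∈ W` satisfies `‖F' 0‖ ≤ M`. -/
def NHyp (n : ℕ) (V : Set (E 2)) : Prop :=
  ∀ a ∈ V, ∃ W ∈ 𝓝[V] a, ∃ M : ℝ, 0 < M ∧
    ∀ F : E n → E 2, (∀ i, HarmOn (Metric.ball (0 : E n) 1) (fun x => F x i)) →
      Set.MapsTo F (Metric.ball (0 : E n) 1) V → F 0 ∈ W → ‖fderiv ℝ F 0‖ ≤ M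


open MeasureTheory

/-- kernel potential -/
def psiK {n : ℕ} (y : E n) : ℝ := expNegInvGlue (1 - ‖y‖ ^ 2)

/-- mean value kernel -/
def phiK {n : ℕ} (y : E n) : ℝ := 2 * (((1 - ‖y‖ ^ 2)⁻¹) ^ 2 * expNegInvGlue (1 - ‖y‖ ^ 2))

lemma hasDerivAt_glue (x : ℝ) :
    HasDerivAt expNegInvGlue ((x⁻¹) ^ 2 * expNegInvGlue x) x := by
  have h := expNegInvGlue.hasDerivAt_polynomial_eval_inv_mul 1 x
  simpa using h

lemma contDiff_psiK {n : ℕ} : ContDiff ℝ 3 (psiK (n := n)) :=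
  (expNegInvGlue.contDiff (n := 3)).comp (contDiff_const.sub (contDiff_norm_sq ℝ))

lemma contDiff_phiK {n : ℕ} : ContDiff ℝ 3 (phiK (n := n)) := by
  have h := expNegInvGlue.contDiff_polynomial_eval_inv_mul (n := 3) (Polynomial.X ^ 2)
  simp only [Polynomial.eval_pow, Polynomial.eval_X] at h
  exact contDiff_const.mul (h.comp (contDiff_const.sub (contDiff_norm_sq ℝ)))

lemma phiK_nonneg {n : ℕ} (y : E n) : 0 ≤ phiK y := by
  have := expNegInvGlue.nonneg (1 - ‖y‖ ^ 2)
  unfold phiK; positivity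

lemma phiK_zero {n : ℕ} (y : E n) (h : 1 ≤ ‖y‖) : phiK y = 0 := by
  unfold phiK
  rw [expNegInvGlue.zero_of_nonpos (by nlinarith)]; simp

lemma psiK_zero {n : ℕ} (y : E n) (h : 1 ≤ ‖y‖) : psiK y = 0 := by
  unfold psiK
  rw [expNegInvGlue.zero_of_nonpos (by nlinarith)]

lemma phiK_pos {n : ℕ} (y : E n) (h : ‖y‖ < 1) : 0 < phiK y := by
  have h1 : 0 < 1 - ‖y‖ ^ 2 := by nlinarith [norm_nonneg y]
  have := expNegInvGlue.pos_of_pos h1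
  unfold phiK; positivity

lemma hcs_phiK {n : ℕ} : HasCompactSupport (phiK (n := n)) :=
  HasCompactSupport.intro (isCompact_closedBall (0 : E n) 1) fun y hy => phiK_zero y (by
    simp at hy; exact hy.le)

lemma hcs_psiK {n : ℕ} : HasCompactSupport (psiK (n := n)) :=
  HasCompactSupport.intro (isCompact_closedBall (0 : E n) 1) fun y hy => psiK_zero y (by
    simp at hy; exact hy.le)

lemma fderiv_psiK {n : ℕ} (y v : E n) : fderiv ℝ psiK y v = - (phiK y * inner ℝ y v) := by
  have h := (hasDerivAt_glue (1 - ‖y‖ ^ 2)).comp_hasFDerivAt y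
    ((hasStrictFDerivAt_norm_sq y).hasFDerivAt.const_sub 1)
  have h2 : HasFDerivAt (psiK (n := n)) _ y := h
  rw [h2.fderiv]
  simp [phiK]
  ring

lemma inner_eq_sum {n : ℕ} (L : E n →L[ℝ] ℝ) (y : E n) :
    L y = ∑ i, L (EuclideanSpace.single i 1) * inner ℝ y (EuclideanSpace.single i (1:ℝ)) := by
  conv_lhs => rw [← (EuclideanSpace.basisFun (Fin n) ℝ).sum_repr y]
  simp [EuclideanSpace.inner_single_right, mul_comm]

lemma hasFDerivAt_scale {n : ℕ} {f : E n → ℝ} (x : E n) (r : ℝ) (y : E n)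
    (hf : DifferentiableAt ℝ f (x + r • y)) :
    HasFDerivAt (fun y => f (x + r • y)) (r • fderiv ℝ f (x + r • y)) y := by
  have h1 : HasFDerivAt (fun y : E n => x + r • y) (r • ContinuousLinearMap.id ℝ (E n)) y :=
    ((hasFDerivAt_id y).const_smul r).const_add x
  refine (hf.hasFDerivAt.comp y h1).congr_fderiv ?_
  ext; simp

lemma mv_global {n : ℕ} (u : E n → ℝ) (hu : ContDiff ℝ 2 u) (hc : HasCompactSupport u) (x : E n)
    (ρ : ℝ) (hρ : 0 < ρ) (h : ∀ y ∈ ball x ρ, lap u y = 0) :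
    ∫ y, u (x + ρ • y) * phiK y = (∫ y : E n, phiK y) * u x := by
  have hd : Differentiable ℝ u := hu.differentiable (by norm_num)
  have hdc : Continuous (fderiv ℝ u) := hu.continuous_fderiv (by norm_num)
  have hd1 : ∀ v, ContDiff ℝ 1 (fun y => fderiv ℝ u y v) := fun v =>
    (hu.fderiv_right (m := 1) (by norm_num)).clm_apply contDiff_const
  obtain ⟨B, hB⟩ := (hc.fderiv (𝕜 := ℝ)).exists_bound_of_continuous hdc
  have hφc := (contDiff_phiK (n := n)).continuous
  have hψc := (contDiff_psiK (n := n)).continuous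
  have key : ∀ r : ℝ, HasDerivAt (fun r : ℝ => ∫ y, u (x + r • y) * phiK y)
      (∫ y, fderiv ℝ u (x + r • y) y * phiK y) r := by
    intro r
    refine (hasDerivAt_integral_of_dominated_loc_of_deriv_le
      (F := fun (r : ℝ) y => u (x + r • y) * phiK y)
      (F' := fun (r : ℝ) y => fderiv ℝ u (x + r • y) y * phiK y)
      (bound := fun y => B * ‖y‖ * phiK y) univ_mem ?_ ?_ ?_ ?_ ?_ ?_).2
    · refine Eventually.of_forall fun r => Continuous.aestronglyMeasurable ?_
      have := hd.continuous
      fun_prop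
    · refine Continuous.integrable_of_hasCompactSupport ?_ hcs_phiK.mul_left
      have := hd.continuous
      fun_prop
    · refine Continuous.aestronglyMeasurable ?_
      exact ((hdc.comp (by fun_prop)).clm_apply continuous_id).mul hφc
    · refine Eventually.of_forall fun y r _ => ?_
      rw [norm_mul, Real.norm_of_nonneg (phiK_nonneg y)]
      gcongr
      · exact phiK_nonneg y
      · exact ((fderiv ℝ u (x + r • y)).le_opNorm y).trans (by gcongr; exact hB _)
    · refine Continuous.integrable_of_hasCompactSupport ?_ hcs_phiK.mul_left
      fun_prop
    · refine Eventually.of_forall fun y r _ => ?_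
      have h1 : HasDerivAt (fun r : ℝ => x + r • y) y r := by
        simpa using ((hasDerivAt_id r).smul_const y).const_add x
      exact ((hd (x + r • y)).hasFDerivAt.comp_hasDerivAt r h1).mul_const _
  have zero : ∀ r : ℝ, 0 ≤ r → r ≤ ρ → ∫ y, fderiv ℝ u (x + r • y) y * phiK y = 0 := by
    intro r hr0 hr
    have hrd : ∀ (v : E n) (y : E n), HasFDerivAt (fun y => fderiv ℝ u (x + r • y) v)
        (r • fderiv ℝ (fun y => fderiv ℝ u y v) (x + r • y)) y := by
      intro v y
      exact hasFDerivAt_scale x r y ((hd1 v).differentiable (by norm_num) (x + r • y))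
    have hrc : ∀ v : E n, Continuous (fun y => fderiv ℝ u (x + r • y) v) := fun v =>
      (hd1 v).continuous.comp (by fun_prop)
    have hrcc : ∀ v : E n, Continuous
        (fun y => fderiv ℝ (fun y => fderiv ℝ u y v) (x + r • y) v) := fun v =>
      (((hd1 v).continuous_fderiv (by norm_num)).comp (by fun_prop)).clm_apply continuous_const
    have hψ1 : ∀ v : E n, Continuous (fun y => fderiv ℝ (psiK (n := n)) y v) := fun v =>
      ((contDiff_psiK (n := n)).continuous_fderiv (by norm_num)).clm_apply continuous_const
    have ibp : ∀ v : E n, ∫ y, fderiv ℝ u (x + r • y) v * fderiv ℝ psiK y v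
        = - ∫ y, r * fderiv ℝ (fun y => fderiv ℝ u y v) (x + r • y) v * psiK y := by
      intro v
      have := integral_mul_fderiv_eq_neg_fderiv_mul_of_integrable (μ := volume) (v := v)
        (f := fun y => fderiv ℝ u (x + r • y) v) (g := psiK (n := n)) ?_ ?_ ?_ ?_ ?_
      · rw [this]
        congr 2
        ext y
        rw [(hrd v y).fderiv]; simp
      · simp_rw [fun y => (hrd v y).fderiv]
        refine Continuous.integrable_of_hasCompactSupport ?_ hcs_psiK.mul_left
        simp only [smul_apply, smul_eq_mul]
        exact (continuous_const.mul (hrcc v)).mul hψc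
      · refine Continuous.integrable_of_hasCompactSupport ((hrc v).mul (hψ1 v))
          (hcs_psiK.fderiv_apply (𝕜 := ℝ) v).mul_left
      · exact Continuous.integrable_of_hasCompactSupport ((hrc v).mul hψc) hcs_psiK.mul_left
      · exact fun y _ => (hrd v y).differentiableAt
      · exact fun y _ => (contDiff_psiK (n := n)).differentiable (by norm_num) y
    have e1 : ∀ y : E n, fderiv ℝ u (x + r • y) y * phiK y
        = - ∑ i, fderiv ℝ u (x + r • y) (EuclideanSpace.single i 1)
            * fderiv ℝ psiK y (EuclideanSpace.single i 1) := by
      intro y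
      rw [inner_eq_sum (fderiv ℝ u (x + r • y)) y, Finset.sum_mul, ← Finset.sum_neg_distrib]
      refine Finset.sum_congr rfl fun i _ => ?_
      rw [fderiv_psiK]; ring
    simp_rw [e1]
    rw [integral_neg, integral_finsetSum]
    · simp_rw [ibp]
      rw [Finset.sum_neg_distrib, neg_neg, ← integral_finsetSum]
      · rw [← integral_zero (E n) ℝ (μ := volume)]
        congr 1
        ext y
        by_cases hy : ‖y‖ < 1
        · have := h (x + r • y) (by
            rw [mem_ball, dist_eq_norm, add_sub_cancel_left, norm_smul, Real.norm_of_nonneg hr0]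
            rcases hr0.eq_or_lt with h | h
            · rw [← h]; simpa using hρ
            · nlinarith)
          unfold lap at this
          rw [← Finset.sum_mul, ← Finset.mul_sum, this]; simp
        · simp [psiK_zero y (not_lt.1 hy)]
      · intro i _
        refine Continuous.integrable_of_hasCompactSupport ?_ hcs_psiK.mul_left
        exact (continuous_const.mul (hrcc _)).mul hψc
    · intro i _
      exact Continuous.integrable_of_hasCompactSupport ((hrc _).mul (hψ1 _))
          (hcs_psiK.fderiv_apply (𝕜 := ℝ) _).mul_left
  have := constant_of_has_deriv_right_zero (f := fun r : ℝ => ∫ y, u (x + r • y) * phiK y)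
    (a := 0) (b := ρ) (fun r _ => (key r).continuousAt.continuousWithinAt) (fun r hr => by
      have := key r
      rw [zero r hr.1 hr.2.le] at this
      exact this.hasDerivWithinAt) ρ ⟨hρ.le, le_rfl⟩
  rw [this]
  simp [integral_const_mul, mul_comm]

lemma HarmOn.mono {n : ℕ} {U V : Set (E n)} {u : E n → ℝ} (h : HarmOn U u) (hV : V ⊆ U) :
    HarmOn V u := ⟨h.1.mono hV, fun x hx => h.2 x (hV hx)⟩

lemma HarmOn.diffAt {n : ℕ} {U : Set (E n)} {u : E n → ℝ} (h : HarmOn U u) (hU : IsOpen U)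
    {x : E n} (hx : x ∈ U) : DifferentiableAt ℝ u x :=
  ((h.1.contDiffAt (hU.mem_nhds hx)).differentiableAt (by norm_num))

lemma HarmOn.diffAt2 {n : ℕ} {U : Set (E n)} {u : E n → ℝ} (h : HarmOn U u) (hU : IsOpen U)
    {x : E n} (hx : x ∈ U) (v : E n) : DifferentiableAt ℝ (fun y => fderiv ℝ u y v) x :=
  ((((h.1.contDiffAt (hU.mem_nhds hx)).fderiv_right (m := 1) (by norm_num)).clm_apply
    contDiffAt_const).differentiableAt (by norm_num))

lemma lap_congr {n : ℕ} {u w : E n → ℝ} {x : E n} (h : u =ᶠ[𝓝 x] w) : lap u x = lap w x := by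
  unfold lap
  refine Finset.sum_congr rfl fun i _ => ?_
  have : (fun y => fderiv ℝ u y (EuclideanSpace.single i 1)) =ᶠ[𝓝 x]
      (fun y => fderiv ℝ w y (EuclideanSpace.single i 1)) := by
    filter_upwards [h.eventuallyEq_nhds] with y hy
    rw [hy.fderiv_eq]
  rw [this.fderiv_eq]

lemma HarmOn.neg {n : ℕ} {U : Set (E n)} {u : E n → ℝ} (h : HarmOn U u) :
    HarmOn U (fun x => - u x) := by
  refine ⟨h.1.neg, fun x hx => ?_⟩
  have := h.2 x hx
  unfold lap at this ⊢
  simp only [fderiv_fun_neg, neg_apply, Finset.sum_neg_distrib, this, neg_zero]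

lemma HarmOn.scale {n : ℕ} {U V : Set (E n)} {u : E n → ℝ} (h : HarmOn U u) (hU : IsOpen U)
    (hVo : IsOpen V)
    (x : E n) (r : ℝ) (hV : ∀ y ∈ V, x + r • y ∈ U) : HarmOn V (fun y => u (x + r • y)) := by
  refine ⟨h.1.comp (ContDiff.contDiffOn (by fun_prop)) hV, fun y hy => ?_⟩
  have h0 := h.2 _ (hV y hy)
  have h1 : ∀ v : E n, (fun y => fderiv ℝ (fun y => u (x + r • y)) y v) =ᶠ[𝓝 y]
      (fun y => r * fderiv ℝ u (x + r • y) v) := by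
    intro v
    filter_upwards [hVo.mem_nhds hy] with z hz
    rw [(hasFDerivAt_scale x r z (h.diffAt hU (hV z hz))).fderiv]; simp
  unfold lap at h0 ⊢
  have h2 : ∀ v : E n, fderiv ℝ (fun y => fderiv ℝ (fun y => u (x + r • y)) y v) y v
      = r * r * fderiv ℝ (fun y => fderiv ℝ u y v) (x + r • y) v := by
    intro v
    rw [(h1 v).fderiv_eq]
    have h3 := (hasFDerivAt_scale x r y (h.diffAt2 hU (hV y hy) v)).const_mul r
    rw [h3.fderiv]; simp; ring
  simp_rw [h2]
  rw [← Finset.mul_sum, h0, mul_zero]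

lemma scale_fderiv {n : ℕ} {U : Set (E n)} {u : E n → ℝ} (h : HarmOn U u) (hU : IsOpen U)
    (x : E n) (r : ℝ) (y : E n) (hy : x + r • y ∈ U) :
    fderiv ℝ (fun y => u (x + r • y)) y = r • fderiv ℝ u (x + r • y) :=
  (hasFDerivAt_scale x r y (h.diffAt hU hy)).fderiv

/-- cutoff -/
lemma cutoff {n : ℕ} {R ρ : ℝ} (hρ : 0 < ρ) (hR : ρ < R) {x : E n} {u : E n → ℝ}
    (h : HarmOn (ball x R) u) : ∃ w : E n → ℝ, ContDiff ℝ 2 w ∧ HasCompactSupport w ∧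
      (∀ y ∈ closedBall x ρ, w y = u y) ∧ ∀ y ∈ ball x ρ, lap w y = 0 := by
  let χ : ContDiffBump x := ⟨ρ, (ρ + R) / 2, hρ, by linarith⟩
  have hE : ∀ y ∈ closedBall x ρ, χ y * u y = u y := fun y hy => by
    rw [χ.one_of_mem_closedBall hy, one_mul]
  refine ⟨fun y => χ y * u y, ?_, χ.hasCompactSupport.mul_right, hE, ?_⟩
  · rw [contDiff_iff_contDiffAt]
    intro y
    by_cases hy : y ∈ ball x R
    · exact χ.contDiffAt.mul (h.1.contDiffAt (isOpen_ball.mem_nhds hy))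
    · have : (fun y => χ y * u y) =ᶠ[𝓝 y] fun _ => 0 := by
        have h1 : y ∈ (closedBall x ((ρ + R) / 2))ᶜ := by
          simp only [Set.mem_compl_iff, mem_closedBall, mem_ball] at hy ⊢; linarith
        filter_upwards [isClosed_closedBall.isOpen_compl.mem_nhds h1] with z hz
        rw [χ.zero_of_le_dist (by
          simp only [Set.mem_compl_iff, mem_closedBall, not_le] at hz; exact hz.le), zero_mul]
      exact contDiffAt_const.congr_of_eventuallyEq this
  · intro y hy
    rw [← h.2 y (ball_subset_ball hR.le hy)]
    apply lap_congr
    filter_upwards [isOpen_ball.mem_nhds hy] with z hz using hE z (ball_subset_closedBall hz)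

lemma c0_pos {n : ℕ} : 0 < ∫ y : E n, phiK y := by
  refine Continuous.integral_pos_of_hasCompactSupport_nonneg_nonzero
    contDiff_phiK.continuous hcs_phiK phiK_nonneg (x := 0) (phiK_pos 0 (by simp)).ne'

lemma mv_global' {n : ℕ} (u : E n → ℝ) (hu : ContDiff ℝ 2 u) (hc : HasCompactSupport u) (x : E n)
    (ρ : ℝ) (hρ : 0 < ρ) (h : ∀ y ∈ ball x ρ, lap u y = 0) :
    ∫ z, u z * phiK (ρ⁻¹ • (z - x)) = ρ ^ n * (∫ y : E n, phiK y) * u x := by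
  have h1 := mv_global u hu hc x ρ hρ h
  have h2 := Measure.integral_comp_inv_smul_of_nonneg (volume : Measure (E n))
    (fun y => u (x + ρ • y) * phiK y) hρ.le
  have h3 := integral_sub_right_eq_self (μ := volume)
    (fun z => u (x + z) * phiK (ρ⁻¹ • z)) x
  simp only [smul_inv_smul₀ hρ.ne', finrank_euclideanSpace, Fintype.card_fin, smul_eq_mul,
    add_sub_cancel] at h2 h3
  rw [h3, h2, h1, mul_assoc]

set_option maxHeartbeats 1000000 in
lemma harnack (n : ℕ) : ∃ C : ℝ, 0 < C ∧ ∀ (u : E n → ℝ) (R : ℝ), 1 < R →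
    HarmOn (ball (0 : E n) R) u → (∀ y ∈ ball (0 : E n) 1, 0 < u y) →
    ∀ y : E n, ‖y‖ ≤ 1 / 8 → u 0 ≤ C * u y := by
  obtain ⟨B, hB⟩ := (hcs_phiK (n := n)).exists_bound_of_continuous contDiff_phiK.continuous
  obtain ⟨p, hp, hpm⟩ := (isCompact_closedBall (0 : E n) (1 / 2)).exists_isMinOn
    ⟨0, by simp⟩ (contDiff_phiK (n := n)).continuous.continuousOn
  set m := phiK p with hm
  have hm0 : 0 < m := phiK_pos p (by simp at hp; linarith)
  have hB0 : 0 < B := (phiK_pos (0 : E n) (by simp)).trans_le ((le_abs_self _).trans (hB 0))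
  have c0 := c0_pos (n := n)
  refine ⟨(8 : ℝ) ^ n * (B / m), by positivity, fun u R hR hu hpos y hy => ?_⟩
  obtain ⟨w, hw, hwc, hwe, hwl⟩ := cutoff one_pos hR hu
  have hwe' : ∀ z : E n, ‖z‖ < 1 → w z = u z := fun z hz => hwe z (by simpa using hz.le)
  have e1 := mv_global' w hw hwc 0 (1 / 8) (by norm_num)
    fun z hz => hwl z (ball_subset_ball (by norm_num) hz)
  have e2 := mv_global' w hw hwc y (1 / 2) (by norm_num)
    fun z hz => hwl z (by
      rw [mem_ball, dist_eq_norm] at hz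
      rw [mem_ball, dist_zero_right]
      have := norm_le_norm_add_norm_sub' z y
      linarith)
  rw [hwe' 0 (by simp)] at e1
  rw [hwe' y (by linarith)] at e2
  have hle : ∫ z, w z * phiK ((1 / 8 : ℝ)⁻¹ • (z - 0)) ≤
      ∫ z, (B / m) * (w z * phiK ((1 / 2 : ℝ)⁻¹ • (z - y))) := by
    have hφc := (contDiff_phiK (n := n)).continuous
    have hwcc := hw.continuous
    refine integral_mono
      (Continuous.integrable_of_hasCompactSupport (by fun_prop) hwc.mul_right)
      ((Continuous.integrable_of_hasCompactSupport (by fun_prop) hwc.mul_right).const_mul _) ?_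
    intro z
    simp only
    by_cases hz : ‖z‖ < 1 / 8
    · have h1 : 0 < w z := by rw [hwe' z (by linarith)]; exact hpos z (by simp; linarith)
      have h2 : m ≤ phiK ((1 / 2 : ℝ)⁻¹ • (z - y)) := hpm (by
        rw [mem_closedBall, dist_zero_right, norm_smul]
        have := norm_sub_le z y
        norm_num; linarith)
      have h3 : phiK ((1 / 8 : ℝ)⁻¹ • (z - 0)) ≤ B := (le_abs_self _).trans (hB _)
      calc w z * phiK ((1 / 8 : ℝ)⁻¹ • (z - 0)) ≤ w z * B := by gcongr
        _ = B / m * (w z * m) := by field_simp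
        _ ≤ _ := by gcongr
    · rw [phiK_zero ((1 / 8 : ℝ)⁻¹ • (z - 0))]
      · rw [mul_zero]
        by_cases hz2 : ‖z‖ < 1
        · have h1 : 0 < w z := by rw [hwe' z (by linarith)]; exact hpos z (by simpa using hz2)
          have := phiK_nonneg ((1 / 2 : ℝ)⁻¹ • (z - y))
          positivity
        · rw [phiK_zero ((1 / 2 : ℝ)⁻¹ • (z - y))]
          · simp
          · rw [norm_smul]
            have := norm_le_norm_add_norm_sub' z y
            norm_num; linarith
      · rw [norm_smul, sub_zero]; norm_num; linarith
  rw [integral_const_mul, e1, e2] at hle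
  have huy := hpos y (by simp; linarith)
  have h5 : ((1 / 2 : ℝ)) ^ n ≤ 1 := pow_le_one₀ (by norm_num) (by norm_num)
  have h6 : ((1 / 8 : ℝ)) ^ n * 8 ^ n = 1 := by rw [← mul_pow]; norm_num
  generalize (∫ y : E n, phiK y) = c at hle c0
  have h7 : (1 / 8 : ℝ) ^ n * c * u 0 ≤ B / m * (c * u y) := hle.trans (by
    gcongr
    calc (1 / 2 : ℝ) ^ n * c ≤ 1 * c := by gcongr
      _ = c := one_mul c)
  have h8 : c * u 0 ≤ c * (8 ^ n * (B / m) * u y) := by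
    calc c * u 0 = 8 ^ n * ((1 / 8 : ℝ) ^ n * c * u 0) := by linear_combination (- c * u 0) * h6
      _ ≤ 8 ^ n * (B / m * (c * u y)) := by gcongr
      _ = _ := by ring
  exact le_of_mul_le_mul_left h8 c0

lemma int_bound {n : ℕ} {F : Type*} [NormedAddCommGroup F] [NormedSpace ℝ F] (f : E n → F) (C : ℝ)
    (h0 : ∀ z, 2 < ‖z‖ → f z = 0) (hb : ∀ z, ‖z‖ ≤ 2 → ‖f z‖ ≤ C) :
    ‖∫ z, f z‖ ≤ C * (volume : Measure (E n)).real (closedBall 0 2) := by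
  rw [← setIntegral_eq_integral_of_forall_compl_eq_zero (s := closedBall (0 : E n) 2)
    (fun z hz => h0 z (by simpa using hz))]
  exact norm_setIntegral_le_of_norm_le_const measure_closedBall_lt_top
    (fun z hz => hb z (by simpa using hz))

lemma phiK_taylor (n : ℕ) : ∃ L : ℝ, 0 ≤ L ∧ ∀ z x : E n,
    |phiK (z - x) - phiK z + fderiv ℝ phiK z x| ≤ L * ‖x‖ ^ 2 := by
  have h1 : ContDiff ℝ 1 (fderiv ℝ (phiK (n := n))) :=
    (contDiff_phiK (n := n)).fderiv_right (by norm_num)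
  obtain ⟨L, hL⟩ := h1.lipschitzWith_of_hasCompactSupport (hcs_phiK.fderiv (𝕜 := ℝ)) (by norm_num)
  refine ⟨L, L.2, fun z x => ?_⟩
  have := (convex_closedBall z ‖x‖).norm_image_sub_le_of_norm_hasFDerivWithin_le'
    (f := phiK (n := n)) (f' := fderiv ℝ phiK) (φ := fderiv ℝ phiK z) (C := L * ‖x‖)
    (x := z) (y := z - x)
    (fun y _ => ((contDiff_phiK (n := n)).differentiable (by norm_num)
      y).hasFDerivAt.hasFDerivWithinAt)
    (fun y hy => (hL.norm_sub_le y z).trans (by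
      gcongr; rwa [mem_closedBall, dist_eq_norm] at hy))
    (by simp) (by simp)
  simp only [sub_sub_cancel_left, map_neg, sub_neg_eq_add, norm_neg, Real.norm_eq_abs] at this
  rw [pow_two, ← mul_assoc]
  exact this

set_option maxHeartbeats 1000000 in
lemma reg (n : ℕ) : ∃ C : ℝ, 0 < C ∧ ∀ (u : E n → ℝ) (A : ℝ), HarmOn (ball (0 : E n) 4) u →
    (∀ y ∈ ball (0 : E n) 4, |u y| ≤ A) → ‖fderiv ℝ u 0‖ ≤ C * A ∧
    ∀ x : E n, ‖x‖ ≤ 1 → |u x - u 0 - fderiv ℝ u 0 x| ≤ C * A * ‖x‖ ^ 2 := by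
  obtain ⟨L, hL0, hL⟩ := phiK_taylor n
  obtain ⟨B, hB⟩ := (hcs_phiK.fderiv (𝕜 := ℝ)).exists_bound_of_continuous
    ((contDiff_phiK (n := n)).continuous_fderiv (by norm_num))
  have c0 := c0_pos (n := n)
  have hφc := (contDiff_phiK (n := n)).continuous
  have hφd := (contDiff_phiK (n := n)).continuous_fderiv (by norm_num)
  have hB0 : 0 ≤ B := (norm_nonneg _).trans (hB 0)
  obtain ⟨V, hV⟩ : ∃ V, V = (volume : Measure (E n)).real (closedBall 0 2) := ⟨_, rfl⟩
  have hV0 : 0 ≤ V := hV ▸ measureReal_nonneg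
  obtain ⟨c, hc⟩ : ∃ c, c = ∫ y : E n, phiK y := ⟨_, rfl⟩
  rw [← hc] at c0
  refine ⟨c⁻¹ * (V * (B + L)) + 1, by positivity, fun u A hu hA => ?_⟩
  have hA0 : 0 ≤ A := (abs_nonneg _).trans (hA 0 (by simp))
  obtain ⟨w, hw, hwc, hwe, hwl⟩ := cutoff (ρ := 3) (by norm_num) (by norm_num) hu
  have hwcc := hw.continuous
  have hwA : ∀ z : E n, ‖z‖ ≤ 3 → |w z| ≤ A := fun z hz => by
    rw [hwe z (by simpa using hz)]; exact hA z (by simp; linarith)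
  have mv : ∀ x : E n, ‖x‖ ≤ 1 → ∫ z, w z * phiK (z - x) = c * u x := by
    intro x hx
    have := mv_global' w hw hwc x 1 one_pos (fun z hz => hwl z (by
      rw [mem_ball, dist_eq_norm] at hz
      rw [mem_ball, dist_zero_right]
      have := norm_le_norm_add_norm_sub' z x
      linarith))
    rw [hwe x (by simp; linarith), ← hc] at this
    simpa using this
  have hfd0 : ∀ z : E n, 2 < ‖z‖ → fderiv ℝ (phiK (n := n)) z = 0 := by
    intro z hz
    have : (phiK (n := n)) =ᶠ[𝓝 z] fun _ => 0 := by
      filter_upwards [(isOpen_lt continuous_const continuous_norm).mem_nhds hz] with y hy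
      have hy' : 2 < ‖y‖ := hy
      exact phiK_zero y (by linarith)
    rw [this.fderiv_eq]; simp
  obtain ⟨ℓ, hℓ⟩ : ∃ ℓ : E n →L[ℝ] ℝ, ℓ = - (c⁻¹ • ∫ z, w z • fderiv ℝ (phiK (n := n)) z) :=
    ⟨_, rfl⟩
  have hintg : Integrable (fun z => w z • fderiv ℝ (phiK (n := n)) z) :=
    Continuous.integrable_of_hasCompactSupport (hwcc.smul hφd) hwc.smul_right
  have hℓn : ‖ℓ‖ ≤ c⁻¹ * (A * B * V) := by
    rw [hℓ, norm_neg, norm_smul, Real.norm_of_nonneg (by positivity), hV]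
    gcongr
    apply int_bound
    · intro z hz
      rw [hfd0 z hz, smul_zero]
    · intro z hz
      rw [norm_smul]
      have := hwA z (by linarith)
      gcongr
      · exact this
      · exact hB z
  have quad : ∀ x : E n, ‖x‖ ≤ 1 → |u x - u 0 - ℓ x| ≤ c⁻¹ * (A * (L * ‖x‖ ^ 2) * V) := by
    intro x hx
    have e1 := mv x hx
    have e2 := mv 0 (by simp)
    have e3 : ℓ x = - (c⁻¹ * ∫ z, w z * fderiv ℝ (phiK (n := n)) z x) := by
      rw [hℓ]
      simp only [neg_apply, smul_apply, smul_eq_mul]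
      rw [ContinuousLinearMap.integral_apply hintg]
      simp
    have i1 : Integrable (fun z => w z * phiK (z - x)) :=
      Continuous.integrable_of_hasCompactSupport (by fun_prop) hwc.mul_right
    have i2 : Integrable (fun z => w z * phiK (z - 0)) :=
      Continuous.integrable_of_hasCompactSupport (by fun_prop) hwc.mul_right
    have i3 : Integrable (fun z => w z * fderiv ℝ (phiK (n := n)) z x) :=
      Continuous.integrable_of_hasCompactSupport (hwcc.mul (hφd.clm_apply continuous_const))
        hwc.mul_right
    have e4 : u x - u 0 - ℓ x = c⁻¹ * ∫ z, w z * (phiK (z - x) - phiK z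
        + fderiv ℝ (phiK (n := n)) z x) := by
      have : ∫ z, w z * (phiK (z - x) - phiK z + fderiv ℝ (phiK (n := n)) z x)
          = (∫ z, w z * phiK (z - x)) - (∫ z, w z * phiK (z - 0)) +
            ∫ z, w z * fderiv ℝ (phiK (n := n)) z x := by
        rw [← integral_sub i1 i2, ← integral_add (by exact i1.sub i2) i3]
        congr 1; ext z; simp; ring
      rw [this, e1, e2, e3]
      field_simp
      ring
    rw [e4, abs_mul, abs_of_nonneg (by positivity : 0 ≤ c⁻¹), hV]
    gcongr
    rw [← Real.norm_eq_abs]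
    apply int_bound
    · intro z hz
      rw [hfd0 z hz, phiK_zero z (by linarith), phiK_zero (z - x)]
      · simp
      · have := norm_sub_norm_le z x
        linarith
    · intro z hz
      rw [norm_mul]
      have := hwA z (by linarith)
      gcongr
      · exact this
      · exact hL z x
  have hD : HasFDerivAt u ℓ 0 := by
    rw [hasFDerivAt_iff_isLittleO_nhds_zero]
    refine Asymptotics.IsBigO.trans_isLittleO (g := fun x : E n => ‖x‖ ^ 2) ?_
      (Asymptotics.isLittleO_norm_pow_id (by norm_num))
    refine Asymptotics.IsBigO.of_bound (c⁻¹ * (A * L * V)) ?_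
    filter_upwards [closedBall_mem_nhds (0 : E n) one_pos] with x hx
    have := quad x (by simpa using hx)
    simp only [zero_add, norm_pow, Real.norm_eq_abs, abs_norm]
    refine this.trans (le_of_eq (by ring))
  rw [hD.fderiv]
  have hci : 0 ≤ c⁻¹ := by positivity
  constructor
  · refine hℓn.trans ?_
    have : 0 ≤ c⁻¹ * (V * L) * A := by positivity
    nlinarith
  · intro x hx
    refine (quad x hx).trans ?_
    have : 0 ≤ c⁻¹ * (V * B) * A * ‖x‖ ^ 2 := by positivity
    have : 0 ≤ A * ‖x‖ ^ 2 := by positivity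
    nlinarith

lemma second_test (g g' : ℝ → ℝ) (c : ℝ) (hmin : IsLocalMin g 0)
    (hg : ∀ᶠ t in 𝓝 0, HasDerivAt g (g' t) t) (hg' : HasDerivAt g' c 0) : 0 ≤ c := by
  by_contra hc
  push Not at hc
  have e : deriv g =ᶠ[𝓝 0] g' := hg.mono fun t ht => ht.deriv
  have d2 : deriv (deriv g) 0 = c := by rw [e.deriv_eq, hg'.deriv]
  have hmax := isLocalMax_of_deriv_deriv_neg (by rw [d2]; exact hc) hmin.deriv_eq_zero
    hg.self_of_nhds.continuousAt
  have ec : g =ᶠ[𝓝 0] fun _ => g 0 := by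
    filter_upwards [hmin, hmax] with t h1 h2 using le_antisymm h2 h1
  have : deriv g =ᶠ[𝓝 0] fun _ => 0 := by
    filter_upwards [ec.eventuallyEq_nhds] with t ht
    rw [ht.deriv_eq]; simp
  rw [this.deriv_eq] at d2
  simp at d2
  linarith

lemma norm_sq_add_single {n : ℕ} (q : E n) (i : Fin n) (t : ℝ) :
    ‖q + t • EuclideanSpace.single i (1 : ℝ)‖ ^ 2 = ‖q‖ ^ 2 + 2 * t * q i + t ^ 2 := by
  rw [norm_add_sq_real, real_inner_smul_right, EuclideanSpace.inner_single_right, norm_smul]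
  simp
  ring

lemma barrier_test {n : ℕ} {U : Set (E n)} (hU : IsOpen U) {u : E n → ℝ} (hu : HarmOn U u)
    (m α b : ℝ) (hm : 0 < m) (hα : 0 < α) (q : E n) (hq : q ∈ U)
    (hN : (n : ℝ) < 2 * α * ‖q‖ ^ 2)
    (hmin : IsLocalMin (fun y => u y - m * (Real.exp (-α * ‖y‖ ^ 2) - b)) q) : False := by
  set N := ‖q‖ ^ 2 with hNdef
  have hi : ∀ i : Fin n,
      0 ≤ fderiv ℝ (fun y => fderiv ℝ u y (EuclideanSpace.single i 1)) q
        (EuclideanSpace.single i 1) - m * ((4 * α ^ 2 * (q i) ^ 2 - 2 * α) * Real.exp (-α * N)) := by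
    intro i
    set e : E n := EuclideanSpace.single i 1 with he
    have hline : ∀ t : ℝ, HasDerivAt (fun t : ℝ => q + t • e) e t := fun t => by
      simpa using ((hasDerivAt_id t).smul_const e).const_add q
    have hc : Tendsto (fun t : ℝ => q + t • e) (𝓝 0) (𝓝 q) := by
      have := (hline 0).continuousAt.tendsto
      simpa using this
    have hex : ∀ t : ℝ, HasDerivAt (fun t : ℝ => Real.exp (-α * (N + 2 * t * q i + t ^ 2)))
        (Real.exp (-α * (N + 2 * t * q i + t ^ 2)) * (-α * (2 * q i + 2 * t))) t := by
      intro t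
      have h1 : HasDerivAt (fun t : ℝ => N + 2 * t * q i + t ^ 2) (2 * q i + 2 * t) t := by
        have h5 := ((((hasDerivAt_id t).const_mul 2).mul_const (q i)).const_add N).add
          (hasDerivAt_pow 2 t)
        refine h5.congr_deriv ?_
        simp
      exact (h1.const_mul (-α)).exp
    refine second_test (fun t : ℝ => u (q + t • e) - m *
        (Real.exp (-α * (N + 2 * t * q i + t ^ 2)) - b))
      (fun t => fderiv ℝ u (q + t • e) e - m *
        (Real.exp (-α * (N + 2 * t * q i + t ^ 2)) * (-α * (2 * q i + 2 * t)))) _ ?_ ?_ ?_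
    · have := hc.eventually hmin
      filter_upwards [this] with t ht
      rw [norm_sq_add_single, ← hNdef] at ht
      simpa using ht
    · filter_upwards [hc.eventually (hU.mem_nhds hq)] with t ht
      have h1 := (hu.diffAt hU ht).hasFDerivAt.comp_hasDerivAt t (hline t)
      exact h1.sub (((hex t).sub_const b).const_mul m)
    · have h0 : q + (0 : ℝ) • e = q := by simp
      have h1 : HasFDerivAt (fun y => fderiv ℝ u y e) (fderiv ℝ (fun y => fderiv ℝ u y e) q)
          (q + (0 : ℝ) • e) := by
        rw [h0]; exact (hu.diffAt2 hU hq e).hasFDerivAt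
      have h2 := h1.comp_hasDerivAt (0 : ℝ) (hline 0)
      have h3 : HasDerivAt (fun t : ℝ => -α * (2 * q i + 2 * t)) (-α * 2) 0 := by
        have := (((hasDerivAt_id (0 : ℝ)).const_mul 2).const_add (2 * q i)).const_mul (-α)
        simpa using this
      have h4 := h2.sub (((hex 0).mul h3).const_mul m)
      refine h4.congr_deriv ?_
      simp
      left
      ring
  have hs := Finset.sum_nonneg (s := Finset.univ) fun i _ => hi i
  rw [Finset.sum_sub_distrib] at hs
  have h0 := hu.2 q hq
  unfold lap at h0
  rw [h0, ← Finset.mul_sum, ← Finset.sum_mul, Finset.sum_sub_distrib, ← Finset.mul_sum] at hs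
  have hNN : ∑ i, (q i) ^ 2 = N := by rw [hNdef, EuclideanSpace.real_norm_sq_eq]
  rw [hNN] at hs
  simp at hs
  have hp : 0 < m * ((4 * α ^ 2 * N - n * (2 * α)) * Real.exp (-(α * N))) := by
    have : 0 < 4 * α ^ 2 * N - n * (2 * α) := by nlinarith
    positivity
  linarith

set_option maxHeartbeats 1000000 in
lemma hopf (n : ℕ) : ∃ C : ℝ, 0 < C ∧ ∀ (u : E n → ℝ) (R : ℝ), 1 < R →
    HarmOn (ball (0 : E n) R) u → (∀ y ∈ ball (0 : E n) 1, 0 < u y) →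
    ∀ p : E n, ‖p‖ = 1 → u p = 0 → u 0 ≤ C * ‖fderiv ℝ u p‖ := by
  obtain ⟨C, hC, hH⟩ := harnack n
  set α : ℝ := 32 * n + 1 with hαd
  have hα : 0 < α := by positivity
  refine ⟨C * (Real.exp (-α) * α)⁻¹, by positivity, fun u R hR hu hpos p hp hup => ?_⟩
  set m := u 0 / C with hmd
  have hm : 0 < m := div_pos (hpos 0 (by simp)) hC
  have hin : ∀ y : E n, ‖y‖ ≤ 1 / 8 → m ≤ u y := fun y hy => by
    rw [hmd, div_le_iff₀' hC]; exact hH u R hR hu hpos y hy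
  have hcont : ∀ y : E n, ‖y‖ ≤ 1 → ContinuousAt u y := fun y hy =>
    (hu.diffAt isOpen_ball (by simp; linarith)).continuousAt
  have hcl : ∀ y : E n, ‖y‖ ≤ 1 → 0 ≤ u y := by
    intro y hy
    have h1 : y ∈ closure (ball (0 : E n) 1) := by
      rw [closure_ball _ one_ne_zero]; simpa using hy
    have := (hcont y hy).continuousWithinAt.mem_closure h1
      (t := Set.Ici 0) (fun z hz => (hpos z hz).le)
    rwa [isClosed_Ici.closure_eq] at this
  set w : E n → ℝ := fun y => u y - m * (Real.exp (-α * ‖y‖ ^ 2) - Real.exp (-α)) with hw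
  have hbar : ∀ y : E n, 1 / 8 ≤ ‖y‖ → ‖y‖ ≤ 1 → 0 ≤ w y := by
    have hK : IsCompact (closedBall (0 : E n) 1 ∩ {y | 1 / 8 ≤ ‖y‖}) :=
      (isCompact_closedBall _ _).inter_right (isClosed_le continuous_const continuous_norm)
    obtain ⟨q, hq, hqm⟩ := hK.exists_isMinOn (f := w) ⟨p, by simp [hp], by simp [hp]; norm_num⟩
      (fun y hy => by
        have h1 := hcont y (by simpa using hy.1)
        have : ContinuousAt w y := by
          apply h1.sub
          fun_prop
        exact this.continuousWithinAt)
    intro y hy1 hy2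
    refine le_trans ?_ (hqm (⟨by simpa using hy2, hy1⟩ :
      y ∈ closedBall (0 : E n) 1 ∩ {y | 1 / 8 ≤ ‖y‖}))
    by_contra hneg
    push Not at hneg
    have hq1 : ‖q‖ ≤ 1 := by simpa using hq.1
    have hq8 : 1 / 8 ≤ ‖q‖ := hq.2
    have hexp : Real.exp (-α * ‖q‖ ^ 2) ≤ 1 := by
      rw [Real.exp_le_one_iff]; nlinarith [sq_nonneg ‖q‖]
    have hexp0 := Real.exp_pos (-α)
    have hn1 : ‖q‖ ≠ 1 := by
      intro h
      have := hcl q hq1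
      simp only [hw, h] at hneg
      simp at hneg
      linarith
    have hn8 : ‖q‖ ≠ 1 / 8 := by
      intro h
      have := hin q h.le
      simp only [hw] at hneg
      nlinarith
    have hlt1 : ‖q‖ < 1 := lt_of_le_of_ne hq1 hn1
    have hlt8 : 1 / 8 < ‖q‖ := lt_of_le_of_ne hq8 (Ne.symm hn8)
    refine barrier_test isOpen_ball hu m α (Real.exp (-α)) hm hα q (by simp; linarith) ?_ ?_
    · rw [hαd]
      have : (1 / 8 : ℝ) ^ 2 ≤ ‖q‖ ^ 2 := by gcongr
      have hn0 : (0 : ℝ) ≤ n := by positivity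
      nlinarith
    · refine (hqm.isLocalMin ?_)
      have h1 : {y : E n | ‖y‖ < 1} ∩ {y | 1 / 8 < ‖y‖} ∈ 𝓝 q :=
        ((isOpen_lt continuous_norm continuous_const).inter
          (isOpen_lt continuous_const continuous_norm)).mem_nhds ⟨hlt1, hlt8⟩
      filter_upwards [h1] with y hy
      have hy2 : 1 / 8 < ‖y‖ := hy.2
      have hy1 : ‖y‖ < 1 := hy.1
      exact ⟨by simpa using hy1.le, hy2.le⟩
  have hpR : p ∈ ball (0 : E n) R := by simp [hp, hR]
  have hd : HasDerivAt (fun s : ℝ => u (p + s • (-p))) (fderiv ℝ u p (-p)) 0 := by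
    have hline : HasDerivAt (fun t : ℝ => p + t • (-p)) (-p) 0 := by
      simpa using ((hasDerivAt_id (0 : ℝ)).smul_const (-p)).const_add p
    have h1 : HasFDerivAt u (fderiv ℝ u p) (p + (0 : ℝ) • (-p)) := by
      have := (hu.diffAt isOpen_ball hpR).hasFDerivAt
      simpa using this
    exact h1.comp_hasDerivAt (0 : ℝ) hline
  have hsl := hd.tendsto_slope_zero_right
  have hge : m * (Real.exp (-α) * α) ≤ fderiv ℝ u p (-p) := by
    refine ge_of_tendsto hsl ?_
    have : Set.Ioo (0 : ℝ) (7 / 8) ∈ 𝓝[>] (0 : ℝ) := Ioo_mem_nhdsGT (by norm_num)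
    filter_upwards [this] with s hs
    have hns : ‖p + s • (-p)‖ = 1 - s := by
      have : p + s • (-p) = (1 - s) • p := by module
      rw [this, norm_smul, hp, Real.norm_of_nonneg (by linarith [hs.2])]; ring
    have h1 := hbar (p + s • (-p)) (by rw [hns]; linarith [hs.2]) (by rw [hns]; linarith [hs.1])
    simp only [hw, hns] at h1
    simp only [zero_add, zero_smul, add_zero, hup, sub_zero, smul_eq_mul]
    rw [← div_eq_inv_mul, le_div_iff₀ hs.1]
    refine le_trans ?_ (sub_nonneg.1 h1)
    rw [mul_assoc]
    gcongr
    have h2 : -α * (1 - s) ^ 2 = -α + α * (2 * s - s ^ 2) := by ring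
    rw [h2, Real.exp_add]
    have h3 := Real.add_one_le_exp (α * (2 * s - s ^ 2))
    have h4 : α * s ≤ α * (2 * s - s ^ 2) := by
      gcongr; nlinarith [hs.1, hs.2]
    nlinarith [Real.exp_pos (-α)]
  have hle : fderiv ℝ u p (-p) ≤ ‖fderiv ℝ u p‖ := by
    refine (le_abs_self _).trans (((fderiv ℝ u p).le_opNorm (-p)).trans ?_)
    rw [norm_neg, hp, mul_one]
  have hfin := hge.trans hle
  have hk : 0 < Real.exp (-α) * α := by positivity
  rw [mul_assoc, ← div_le_iff₀' hC, ← hmd, ← div_eq_inv_mul, le_div_iff₀ hk]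
  exact hfin

lemma LG_pos (n : ℕ) : ∃ C : ℝ, 1 ≤ C ∧ ∀ (u : E n → ℝ) (x₀ : E n) (R : ℝ),
    HarmOn (ball x₀ R) u → (∀ x ∈ ball x₀ R, u x = 0 → ‖fderiv ℝ u x‖ ≤ 2) →
    ∀ x, 9 * ‖x - x₀‖ < R → u x ≤ C * (‖x - x₀‖ + |u x₀|) := by
  obtain ⟨C₁, hC₁, hH⟩ := harnack n
  obtain ⟨C₂, hC₂, hP⟩ := hopf n
  refine ⟨C₁ + 16 * C₂ + 1, by linarith, fun u x₀ R hu hz x hx => ?_⟩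
  set d := ‖x - x₀‖ with hd
  have hd0 : 0 ≤ d := norm_nonneg _
  have hab := abs_nonneg (u x₀)
  rcases le_or_gt (u x) 0 with hux | hux
  · exact hux.trans (by positivity)
  rcases hd0.eq_or_lt with hd1 | hd1
  · have : x = x₀ := by rw [← sub_eq_zero, ← norm_eq_zero, ← hd, ← hd1]
    rw [← hd1, this, zero_add]
    have := le_abs_self (u x₀)
    nlinarith
  have hsub : ∀ y : E n, ‖y - x‖ ≤ R - d → ‖y - x‖ < R - d → y ∈ ball x₀ R := by
    intro y _ hy
    rw [mem_ball, dist_eq_norm]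
    have := norm_sub_le_norm_sub_add_norm_sub y x x₀
    linarith
  have hsub' : ∀ y : E n, ‖y - x‖ < R - d → y ∈ ball x₀ R := fun y hy => hsub y hy.le hy
  -- rescaling
  have hresc : ∀ r : ℝ, 0 < r → r < R - d →
      HarmOn (ball (0 : E n) ((R - d) / r)) (fun y => u (x + r • y)) := by
    intro r hr hrR
    refine hu.scale isOpen_ball isOpen_ball x r fun y hy => hsub' _ ?_
    rw [add_sub_cancel_left, norm_smul, Real.norm_of_nonneg hr.le]
    rw [mem_ball, dist_zero_right, lt_div_iff₀ hr] at hy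
    linarith
  by_cases hcase : ∀ y, ‖y - x‖ ≤ 8 * d → 0 < u y
  · have h8 : 8 * d < R - d := by linarith
    have := hH _ _ ((one_lt_div (by positivity)).2 h8) (hresc (8 * d) (by positivity) h8)
      (fun y hy => hcase _ (by
        rw [add_sub_cancel_left, norm_smul, Real.norm_of_nonneg (by positivity)]
        rw [mem_ball, dist_zero_right] at hy
        nlinarith)) ((8 * d)⁻¹ • (x₀ - x)) (by
        rw [norm_smul, norm_sub_rev, ← hd, Real.norm_of_nonneg (by positivity)]
        apply le_of_eq; field_simp)
    simp only [smul_zero, add_zero] at this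
    rw [smul_inv_smul₀ (by positivity), add_sub_cancel] at this
    have h1 := le_abs_self (u x₀)
    nlinarith [mul_nonneg hC₂.le hab, mul_nonneg hC₂.le hd0, mul_nonneg hC₁.le hd0]
  · push Not at hcase
    obtain ⟨z, hzd, hzu⟩ := hcase
    have hcK : ContinuousOn u (closedBall x (8 * d)) := fun y hy =>
      (hu.diffAt isOpen_ball (hsub' y (by
        rw [mem_closedBall, dist_eq_norm] at hy; linarith))).continuousAt.continuousWithinAt
    have hK : IsCompact (closedBall x (8 * d) ∩ u ⁻¹' (Set.Iic 0)) := by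
      refine (isCompact_closedBall x (8 * d)).of_isClosed_subset ?_ Set.inter_subset_left
      exact hcK.preimage_isClosed_of_isClosed isClosed_closedBall isClosed_Iic
    obtain ⟨p, hp, hpm⟩ := hK.exists_isMinOn (f := fun y => ‖y - x‖)
      ⟨z, by rw [mem_closedBall, dist_eq_norm]; exact hzd, hzu⟩
      (by fun_prop)
    have hp8 : ‖p - x‖ ≤ 8 * d := by
      have := hp.1; rwa [mem_closedBall, dist_eq_norm] at this
    have hpu : u p ≤ 0 := hp.2
    set r := ‖p - x‖ with hr
    have hr0 : 0 < r := by
      rw [hr, norm_pos_iff, sub_ne_zero]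
      rintro rfl
      linarith
    have hposr : ∀ y, ‖y - x‖ < r → 0 < u y := by
      intro y hy
      by_contra hyu
      push Not at hyu
      have : r ≤ ‖y - x‖ := hpm (⟨by rw [mem_closedBall, dist_eq_norm]; linarith, hyu⟩ :
        y ∈ closedBall x (8 * d) ∩ u ⁻¹' (Set.Iic 0))
      linarith
    have hpR : p ∈ ball x₀ R := hsub' p (by linarith)
    have hpu0 : u p = 0 := by
      refine le_antisymm hpu ?_
      have h1 : p ∈ closure (ball x r) := by
        rw [closure_ball _ hr0.ne', mem_closedBall, dist_eq_norm]
      have := (hu.diffAt isOpen_ball hpR).continuousAt.continuousWithinAt.mem_closure h1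
        (t := Set.Ici 0) (fun z hz => (hposr z (by rwa [mem_ball, dist_eq_norm] at hz)).le)
      rwa [isClosed_Ici.closure_eq] at this
    have hrR : r < R - d := by linarith
    have hpe : x + r • (r⁻¹ • (p - x)) = p := by rw [smul_inv_smul₀ hr0.ne', add_sub_cancel]
    have := hP _ _ ((one_lt_div hr0).2 hrR) (hresc r hr0 hrR)
      (fun y hy => hposr _ (by
        rw [add_sub_cancel_left, norm_smul, Real.norm_of_nonneg hr0.le]
        rw [mem_ball, dist_zero_right] at hy
        nlinarith)) (r⁻¹ • (p - x)) (by
        rw [norm_smul, ← hr, Real.norm_of_nonneg (by positivity)]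
        field_simp) (by simp only [hpe]; exact hpu0)
    rw [scale_fderiv hu isOpen_ball x r _ (by rw [hpe]; exact hpR), hpe, norm_smul,
      Real.norm_of_nonneg hr0.le] at this
    simp only [smul_zero, add_zero] at this
    have h2 := hz p hpR hpu0
    calc u x ≤ C₂ * (r * ‖fderiv ℝ u p‖) := this
      _ ≤ C₂ * ((8 * d) * 2) := by gcongr
      _ ≤ _ := by
        nlinarith [mul_nonneg hC₂.le hab, mul_nonneg hC₁.le hab, mul_nonneg hC₁.le hd0]

lemma LG (n : ℕ) : ∃ C : ℝ, 1 ≤ C ∧ ∀ (u : E n → ℝ) (x₀ : E n) (R : ℝ),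
    HarmOn (ball x₀ R) u → (∀ x ∈ ball x₀ R, u x = 0 → ‖fderiv ℝ u x‖ ≤ 2) →
    ∀ x, 9 * ‖x - x₀‖ < R → |u x| ≤ C * (‖x - x₀‖ + |u x₀|) := by
  obtain ⟨C, hC, h⟩ := LG_pos n
  refine ⟨C, hC, fun u x₀ R hu hz x hx => ?_⟩
  rw [abs_le']
  refine ⟨h u x₀ R hu hz x hx, ?_⟩
  have := h (fun x => - u x) x₀ R hu.neg (fun y hy hy0 => by
    rw [fderiv_fun_neg, norm_neg]; exact hz y hy (by simpa using hy0)) x hx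
  simpa using this

/-- rescaled maps on a ball of radius `R` -/
def GoodMap (n : ℕ) (ω : Set (E 2)) (i : Fin 2) (R : ℝ) (F : E n → E 2) : Prop :=
  (∀ j, HarmOn (ball (0 : E n) R) (fun x => F x j)) ∧ Set.MapsTo F (ball (0 : E n) R) ω ∧
    (∀ j, ∀ x ∈ ball (0 : E n) R, ‖fderiv ℝ (fun x => F x j) x‖ ≤ 2 * Real.cosh (F x j)) ∧
    Real.cosh (F 0 i) ≤ ‖fderiv ℝ (fun x => F x i) 0‖

lemma GoodMap.mono {n : ℕ} {ω : Set (E 2)} {i : Fin 2} {R R' : ℝ} {F : E n → E 2}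
    (h : GoodMap n ω i R F) (hR : R' ≤ R) : GoodMap n ω i R' F :=
  ⟨fun j => (h.1 j).mono (ball_subset_ball hR), h.2.1.mono_left (ball_subset_ball hR),
    fun j x hx => h.2.2.1 j x (ball_subset_ball hR hx), h.2.2.2⟩

lemma norm_fderiv_le {n : ℕ} (F : E n → E 2)
    (h : ∀ j, DifferentiableAt ℝ (fun x => F x j) 0) :
    ‖fderiv ℝ F 0‖ ≤ ‖fderiv ℝ (fun x => F x 0) 0‖ + ‖fderiv ℝ (fun x => F x 1) 0‖ := by
  have hF : DifferentiableAt ℝ F 0 := differentiableAt_euclidean.2 h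
  have hc : ∀ j v, (fderiv ℝ F 0 v) j = fderiv ℝ (fun x => F x j) 0 v := by
    intro j v
    have h2 : HasFDerivAt (fun x => F x j)
        ((EuclideanSpace.proj j : E 2 →L[ℝ] ℝ).comp (fderiv ℝ F 0)) 0 :=
      (EuclideanSpace.proj j : E 2 →L[ℝ] ℝ).hasFDerivAt.comp 0 hF.hasFDerivAt
    rw [h2.fderiv]; rfl
  refine ContinuousLinearMap.opNorm_le_bound _ (by positivity) fun v => ?_
  have h1 : ∀ w : E 2, ‖w‖ ≤ |w 0| + |w 1| := by
    intro w
    rw [EuclideanSpace.norm_eq, Real.sqrt_le_left (by positivity), Fin.sum_univ_two]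
    simp only [Real.norm_eq_abs]
    nlinarith [abs_nonneg (w 0), abs_nonneg (w 1)]
  refine (h1 _).trans ?_
  rw [hc, hc, add_mul]
  have h2 := (fderiv ℝ (fun x => F x 0) 0).le_opNorm v
  have h3 := (fderiv ℝ (fun x => F x 1) 0).le_opNorm v
  rw [Real.norm_eq_abs] at h2 h3
  exact add_le_add h2 h3

lemma coord_le {m : ℕ} (w : E m) (j : Fin m) : |w j| ≤ ‖w‖ := by
  simpa using PiLp.norm_apply_le w j

set_option maxHeartbeats 1000000 in
lemma rescale {n : ℕ} {ω : Set (E 2)} (hnh : ¬ NHyp n ω) (R : ℝ) (hR : 0 < R) :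
    ∃ i F, GoodMap n ω i R F := by
  unfold NHyp at hnh
  push Not at hnh
  obtain ⟨a, haω, ha⟩ := hnh
  set H := Real.cosh (‖a‖ + 1) with hH
  have hH0 : 0 < H := Real.cosh_pos _
  obtain ⟨F, hF, hmaps, hF0, hM⟩ := ha (ball a 1)
    (mem_nhdsWithin_of_mem_nhds (ball_mem_nhds a one_pos)) (8 * H * R) (by positivity)
  set τ : Fin 2 → E n → ℝ := fun j x => ‖fderiv ℝ (fun x => F x j) x‖ / Real.cosh (F x j) with hτ
  set T : E n → ℝ := fun x => max (τ 0 x) (τ 1 x) with hT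
  have hτc : ∀ j, ∀ x ∈ ball (0 : E n) 1, ContinuousAt (τ j) x := by
    intro j x hx
    have h1 := (hF j).1.contDiffAt (isOpen_ball.mem_nhds hx)
    have h2 := (h1.fderiv_right (m := 1) (by norm_num)).continuousAt
    exact h2.norm.div (Real.continuous_cosh.continuousAt.comp h1.continuousAt)
      (Real.cosh_pos _).ne'
  have hTc : ∀ x ∈ ball (0 : E n) 1, ContinuousAt T x := fun x hx =>
    (hτc 0 x hx).max (hτc 1 x hx)
  have hτT : ∀ j x, τ j x ≤ T x := by
    intro j x
    fin_cases j
    · exact le_max_left _ _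
    · exact le_max_right _ _
  have hT0 : 4 * R < T 0 := by
    have hb : ∀ j, ‖fderiv ℝ (fun x => F x j) 0‖ ≤ T 0 * H := by
      intro j
      have h1 := hτT j 0
      simp only [hτ] at h1
      rw [div_le_iff₀ (Real.cosh_pos _)] at h1
      have hTn : 0 ≤ T 0 := le_trans (div_nonneg (norm_nonneg _) (Real.cosh_pos _).le) (hτT j 0)
      refine h1.trans (mul_le_mul_of_nonneg_left ?_ hTn)
      rw [hH, Real.cosh_le_cosh]
      refine (coord_le _ j).trans ?_
      rw [abs_of_nonneg (by positivity)]
      rw [mem_ball, dist_eq_norm] at hF0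
      have := norm_le_norm_add_norm_sub' (F 0) a
      linarith
    have h2 := norm_fderiv_le F (fun j => (hF j).diffAt isOpen_ball (by simp))
    have h3 : 8 * H * R < 2 * H * T 0 := by linarith [hb 0, hb 1]
    nlinarith
  obtain ⟨x₁, hx₁, hmax⟩ := (isCompact_closedBall (0 : E n) (1 / 2)).exists_isMaxOn
    (f := fun x => (1 / 2 - ‖x‖) * T x) ⟨0, by simp⟩ (fun x hx => by
      have := hTc x (by simp at hx ⊢; linarith)
      exact ((continuous_const.sub continuous_norm).continuousAt.mul this).continuousWithinAt)
  have hg : 2 * R < (1 / 2 - ‖x₁‖) * T x₁ := by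
    have : (1 / 2 - ‖(0 : E n)‖) * T 0 ≤ _ := hmax (by simp : (0 : E n) ∈ closedBall 0 (1 / 2))
    simp only [norm_zero, sub_zero] at this
    linarith
  set L := T x₁ with hL
  set δ := 1 / 2 - ‖x₁‖ with hδ
  have hδ0 : 0 ≤ δ := by simp at hx₁; linarith
  have hδp : 0 < δ := by
    rcases hδ0.eq_or_lt with h | h
    · rw [← h] at hg; linarith
    · exact h
  have hLp : 0 < L := by
    by_contra h
    push Not at h
    nlinarith
  have hin : ∀ y : E n, y ∈ ball (0 : E n) R → ‖x₁ + L⁻¹ • y‖ < 1 / 2 - δ / 2 := by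
    intro y hy
    rw [mem_ball, dist_zero_right] at hy
    have h1 : ‖L⁻¹ • y‖ < δ / 2 := by
      rw [norm_smul, Real.norm_of_nonneg (by positivity), ← div_eq_inv_mul, div_lt_iff₀ hLp]
      linarith
    have := norm_add_le x₁ (L⁻¹ • y)
    linarith
  have hin1 : ∀ y : E n, y ∈ ball (0 : E n) R → x₁ + L⁻¹ • y ∈ ball (0 : E n) 1 := by
    intro y hy
    have := hin y hy
    rw [mem_ball, dist_zero_right]; linarith
  have hTb : ∀ y : E n, y ∈ ball (0 : E n) R → T (x₁ + L⁻¹ • y) ≤ 2 * L := by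
    intro y hy
    have h1 := hin y hy
    have h2 : (1 / 2 - ‖x₁ + L⁻¹ • y‖) * T (x₁ + L⁻¹ • y) ≤ δ * L :=
      hmax (by simp only [mem_closedBall, dist_zero_right]; linarith :
        x₁ + L⁻¹ • y ∈ closedBall (0 : E n) (1 / 2))
    by_contra h
    push Not at h
    nlinarith
  obtain ⟨i, hi⟩ : ∃ i, τ i x₁ = L := by
    rcases max_choice (τ 0 x₁) (τ 1 x₁) with h | h
    · exact ⟨0, h.symm⟩
    · exact ⟨1, h.symm⟩
  refine ⟨i, fun y => F (x₁ + L⁻¹ • y), fun j => ?_, fun y hy => hmaps (hin1 y hy),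
    fun j y hy => ?_, ?_⟩
  · exact (hF j).scale isOpen_ball isOpen_ball x₁ L⁻¹ hin1
  · rw [scale_fderiv (hF j) isOpen_ball x₁ L⁻¹ y (hin1 y hy), norm_smul,
      Real.norm_of_nonneg (by positivity)]
    have h1 := (hτT j _).trans (hTb y hy)
    simp only [hτ] at h1
    rw [div_le_iff₀ (Real.cosh_pos _)] at h1
    rw [← div_eq_inv_mul, div_le_iff₀ hLp]
    linarith
  · rw [scale_fderiv (hF i) isOpen_ball x₁ L⁻¹ 0 (hin1 0 (by simpa using hR)), norm_smul,
      Real.norm_of_nonneg (by positivity)]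
    simp only [hτ] at hi
    simp only [smul_zero, add_zero]
    rw [div_eq_iff (Real.cosh_pos _).ne'] at hi
    rw [hi, inv_mul_cancel_left₀ hLp.ne']

lemma good_index {n : ℕ} {ω : Set (E 2)} (hnh : ¬ NHyp n ω) :
    ∃ i, ∀ R : ℝ, ∃ F, GoodMap n ω i R F := by
  by_contra h
  push Not at h
  obtain ⟨R₀, h₀⟩ := h 0
  obtain ⟨R₁, h₁⟩ := h 1
  obtain ⟨i, F, hF⟩ := rescale hnh (max (max R₀ R₁) 1) (by positivity)
  fin_cases i
  · exact h₀ F (hF.mono ((le_max_left _ _).trans (le_max_left _ _)))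
  · exact h₁ F (hF.mono ((le_max_right _ _).trans (le_max_left _ _)))

lemma basic (n : ℕ) : ∃ C : ℝ, 1 ≤ C ∧ ∀ (u : E n → ℝ) (R : ℝ), 10 ≤ R →
    HarmOn (ball (0 : E n) R) u →
    (∀ x ∈ ball (0 : E n) R, ‖fderiv ℝ u x‖ ≤ 2 * Real.cosh (u x)) →
    ‖fderiv ℝ u 0‖ ≤ C * (1 + |u 0|) ∧
    (∀ x, 40 * ‖x‖ ≤ R → |u x - u 0 - fderiv ℝ u 0 x| ≤ C * (R + |u 0|) * ‖x‖ ^ 2 / R ^ 2) ∧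
    (∀ x, 40 * ‖x‖ ≤ R → |u 0| ≤ C * (‖x‖ + |u x|)) := by
  obtain ⟨C₁, hC₁, hreg⟩ := reg n
  obtain ⟨C₂, hC₂, hlg⟩ := LG n
  refine ⟨2000 * (C₁ * C₂) + C₂, ?_, fun u R hR hu hb => ?_⟩
  · have := mul_pos hC₁ (by linarith : 0 < C₂); linarith
  have hC2p : 0 < C₂ := by linarith
  have hz : ∀ x ∈ ball (0 : E n) R, u x = 0 → ‖fderiv ℝ u x‖ ≤ 2 := by
    intro x hx h0
    have := hb x hx
    rw [h0] at this
    simpa using this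
  have hab := abs_nonneg (u 0)
  have key : ∀ r : ℝ, 0 < r → 36 * r ≤ R →
      ‖fderiv ℝ u 0‖ ≤ C₁ * (C₂ * (4 * r + |u 0|)) / r ∧
      ∀ x, ‖x‖ ≤ r → |u x - u 0 - fderiv ℝ u 0 x| ≤
        C₁ * (C₂ * (4 * r + |u 0|)) * (‖x‖ / r) ^ 2 := by
    intro r hr hrR
    have hin : ∀ y ∈ ball (0 : E n) 4, ‖(0 : E n) + r • y‖ < 4 * r := by
      intro y hy
      rw [mem_ball, dist_zero_right] at hy
      rw [zero_add, norm_smul, Real.norm_of_nonneg hr.le]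
      nlinarith
    have h1 := hreg (fun y => u (0 + r • y)) (C₂ * (4 * r + |u 0|))
      (hu.scale isOpen_ball isOpen_ball 0 r (fun y hy => by
        have := hin y hy
        rw [mem_ball, dist_zero_right]; linarith))
      (fun y hy => by
        have h2 := hin y hy
        refine (hlg u 0 R hu hz (0 + r • y) (by rw [sub_zero]; linarith)).trans ?_
        rw [sub_zero]
        gcongr)
    rw [scale_fderiv hu isOpen_ball 0 r 0 (by simp; linarith)] at h1
    simp only [smul_zero, add_zero, zero_add] at h1
    constructor
    · have := h1.1
      rw [norm_smul, Real.norm_of_nonneg hr.le] at this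
      rw [le_div_iff₀ hr]; linarith
    · intro x hx
      have hn : ‖r⁻¹ • x‖ = ‖x‖ / r := by
        rw [norm_smul, Real.norm_of_nonneg (by positivity), div_eq_inv_mul]
      have := h1.2 (r⁻¹ • x) (by rw [hn]; exact (div_le_one hr).2 hx)
      rw [smul_inv_smul₀ hr.ne', hn] at this
      simp only [smul_apply, map_smul, smul_eq_mul, inv_mul_cancel_left₀ hr.ne'] at this
      exact this
  refine ⟨?_, ?_, ?_⟩
  · have := (key (1 / 4) (by norm_num) (by linarith)).1
    refine this.trans ?_
    have : C₁ * (C₂ * (4 * (1 / 4) + |u 0|)) / (1 / 4) = 4 * (C₁ * C₂) * (1 + |u 0|) := by ring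
    rw [this]
    gcongr
    have := mul_pos hC₁ hC2p; linarith
  · intro x hx
    have hRp : 0 < R := by linarith
    refine ((key (R / 36) (by linarith) (by linarith)).2 x
      (by have := norm_nonneg x; linarith)).trans ?_
    have e : C₁ * (C₂ * (4 * (R / 36) + |u 0|)) * (‖x‖ / (R / 36)) ^ 2
      = (1296 * (C₁ * C₂)) * (R / 9 + |u 0|) * ‖x‖ ^ 2 / R ^ 2 := by
      field_simp
      ring
    rw [e]
    have := mul_pos hC₁ hC2p
    gcongr
    · linarith
    · linarith
  · intro x hx
    have hsub : ball x (R / 2) ⊆ ball (0 : E n) R := by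
      apply ball_subset_ball'
      rw [dist_zero_right]; linarith [norm_nonneg x]
    have := hlg u x (R / 2) (hu.mono hsub) (fun y hy => hz y (hsub hy)) 0 (by
      rw [zero_sub, norm_neg]; linarith [norm_nonneg x])
    rw [zero_sub, norm_neg] at this
    refine this.trans ?_
    gcongr
    have := mul_pos hC₁ hC2p; linarith

lemma lim_affine {n : ℕ} {C : ℝ} (u : ℕ → E n → ℝ) (R : ℕ → ℝ) (hR : Tendsto R atTop atTop)
    (hb : ∀ k x, 40 * ‖x‖ ≤ R k →
      |u k x - u k 0 - fderiv ℝ (u k) 0 x| ≤ C * (R k + |u k 0|) * ‖x‖ ^ 2 / R k ^ 2)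
    {a : ℝ} {l : E n →L[ℝ] ℝ} (ha : Tendsto (fun k => u k 0) atTop (𝓝 a))
    (hl : Tendsto (fun k => fderiv ℝ (u k) 0) atTop (𝓝 l)) (x : E n) :
    Tendsto (fun k => u k x) atTop (𝓝 (a + l x)) := by
  have hinv : Tendsto (fun k => (R k)⁻¹) atTop (𝓝 0) := tendsto_inv_atTop_zero.comp hR
  have h1 : Tendsto (fun k => C * ‖x‖ ^ 2 * ((R k)⁻¹ + |u k 0| * (R k)⁻¹ ^ 2)) atTop (𝓝 0) := by
    have := (hinv.add (ha.abs.mul (hinv.pow 2))).const_mul (C * ‖x‖ ^ 2)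
    simpa using this
  have h2 : Tendsto (fun k => u k x - u k 0 - fderiv ℝ (u k) 0 x) atTop (𝓝 0) := by
    apply squeeze_zero_norm' _ h1
    filter_upwards [hR.eventually_ge_atTop (40 * ‖x‖), hR.eventually_gt_atTop 0] with k hk hp
    refine (hb k x hk).trans (le_of_eq ?_)
    field_simp
  have h3 : Tendsto (fun k => fderiv ℝ (u k) 0 x) atTop (𝓝 (l x)) :=
    ((ContinuousLinearMap.apply ℝ ℝ x).continuous.tendsto l).comp hl
  have := (h2.add ha).add h3
  refine (this.congr (fun k => by ring)).trans (by simp)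

lemma cosh_bound {C s : ℝ} (hC : 1 ≤ C) (h : Real.cosh s ≤ C * (1 + |s|)) : |s| ≤ 4 * C := by
  have h1 : 1 + s ^ 2 / 2 ≤ Real.cosh s := by
    rw [← Real.cosh_abs, ← sq_abs]
    have h1 : |s| / 2 ≤ Real.sinh (|s| / 2) := Real.self_le_sinh_iff.2 (by positivity)
    have h2 : Real.cosh |s| = 1 + 2 * Real.sinh (|s| / 2) ^ 2 := by
      have h3 := Real.cosh_two_mul (|s| / 2)
      rw [mul_div_cancel₀ _ (two_ne_zero)] at h3
      rw [h3, Real.cosh_sq]; ring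
    have h4 : 0 ≤ |s| / 2 := by positivity
    nlinarith
  by_contra h2
  push Not at h2
  have : s ^ 2 = |s| ^ 2 := (sq_abs s).symm
  nlinarith

set_option maxHeartbeats 1000000 in
lemma core {n : ℕ} {ω : Set (E 2)} (i j : Fin 2) (hij : i ≠ j)
    (h : ∀ R : ℝ, ∃ F, GoodMap n ω i R F) :
    (∃ a v : E 2, v ≠ 0 ∧ ∀ t : ℝ, a + t • v ∈ closure ω) ∨
    (∀ t N : ℝ, ∃ p ∈ ω, p i = t ∧ N ≤ p j) ∨ (∀ t N : ℝ, ∃ p ∈ ω, p i = t ∧ p j ≤ -N) := by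
  obtain ⟨C, hC, hbas⟩ := basic n
  choose F hF using fun k : ℕ => h ((k : ℝ) + 10)
  have hR : Tendsto (fun k : ℕ => (k : ℝ) + 10) atTop atTop :=
    tendsto_atTop_add_const_right _ _ tendsto_natCast_atTop_atTop
  have hR10 : ∀ k : ℕ, (10 : ℝ) ≤ (k : ℝ) + 10 := fun k => by
    have : (0 : ℝ) ≤ k := k.cast_nonneg
    linarith
  have hB := fun (l : Fin 2) (k : ℕ) =>
    hbas (fun x => F k x l) _ (hR10 k) ((hF k).1 l) ((hF k).2.2.1 l)
  have hu0 : ∀ k, |F k 0 i| ≤ 4 * C := fun k =>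
    cosh_bound hC ((hF k).2.2.2.trans (hB i k).1)
  have hl1 : ∀ k, 1 ≤ ‖fderiv ℝ (fun x => F k x i) 0‖ := fun k =>
    (Real.one_le_cosh _).trans (hF k).2.2.2
  have hl2 : ∀ k, ‖fderiv ℝ (fun x => F k x i) 0‖ ≤ C * (1 + 4 * C) := fun k =>
    (hB i k).1.trans (by have := hu0 k; gcongr)
  have hrep : ∀ p : E 2, p = p i • EuclideanSpace.single i (1 : ℝ)
      + p j • EuclideanSpace.single j (1 : ℝ) := by
    intro p
    ext l
    have : l = i ∨ l = j := by omega
    rcases this with rfl | rfl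
    · simp [hij]
    · simp [hij.symm]
  by_cases hA : ∃ K' : ℝ, ∃ᶠ k in atTop, |F k 0 j| ≤ K'
  · left
    obtain ⟨K', hK'⟩ := hA
    set S : ℕ → ℝ × ℝ × (E n →L[ℝ] ℝ) × (E n →L[ℝ] ℝ) := fun k =>
      (F k 0 i, F k 0 j, fderiv ℝ (fun x => F k x i) 0, fderiv ℝ (fun x => F k x j) 0) with hS
    have hbd : ∃ᶠ k in atTop, S k ∈ closedBall (0 : ℝ × ℝ × (E n →L[ℝ] ℝ) × (E n →L[ℝ] ℝ))
        (4 * C + |K'| + C * (1 + 4 * C) + C * (1 + |K'|)) := by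
      refine hK'.mono fun k hk => ?_
      have hk' : |F k 0 j| ≤ |K'| := hk.trans (le_abs_self _)
      have h3 : ‖fderiv ℝ (fun x => F k x j) 0‖ ≤ C * (1 + |K'|) :=
        (hB j k).1.trans (by gcongr)
      have h1 := hu0 k
      have h2 := hl2 k
      have p1 : 0 ≤ 4 * C := by linarith
      have p2 := abs_nonneg K'
      have p3 : 0 ≤ C * (1 + 4 * C) := by positivity
      have p4 : 0 ≤ C * (1 + |K'|) := by positivity
      rw [mem_closedBall, dist_zero_right]
      simp only [hS, Prod.norm_def, Real.norm_eq_abs, max_le_iff]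
      refine ⟨?_, ?_, ?_, ?_⟩ <;> linarith
    obtain ⟨⟨a, b, l, m⟩, -, φ, hφ, hlim⟩ :=
      tendsto_subseq_of_frequently_bounded isBounded_closedBall hbd
    have c1 : Tendsto (fun k => F (φ k) 0 i) atTop (𝓝 a) := (continuous_fst.tendsto _).comp hlim
    have c' := (continuous_snd.tendsto _).comp hlim
    have c2 : Tendsto (fun k => F (φ k) 0 j) atTop (𝓝 b) := (continuous_fst.tendsto _).comp c'
    have c'' := (continuous_snd.tendsto _).comp c'
    have c3 : Tendsto (fun k => fderiv ℝ (fun x => F (φ k) x i) 0) atTop (𝓝 l) :=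
      (continuous_fst.tendsto _).comp c''
    have c4 : Tendsto (fun k => fderiv ℝ (fun x => F (φ k) x j) 0) atTop (𝓝 m) :=
      (continuous_snd.tendsto _).comp c''
    have hRφ := hR.comp hφ.tendsto_atTop
    have d1 := lim_affine (C := C) (fun k x => F (φ k) x i) _ hRφ
      (fun k x hx => (hB i (φ k)).2.1 x hx) c1 c3
    have d2 := lim_affine (C := C) (fun k x => F (φ k) x j) _ hRφ
      (fun k x hx => (hB j (φ k)).2.1 x hx) c2 c4
    have hl : 1 ≤ ‖l‖ := ge_of_tendsto' c3.norm (fun k => hl1 _)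
    have hl0 : l ≠ 0 := by
      rintro rfl
      simp at hl
      linarith
    obtain ⟨e, he⟩ : ∃ e, l e ≠ 0 := by
      by_contra hh
      push Not at hh
      exact hl0 (ContinuousLinearMap.ext hh)
    refine ⟨a • EuclideanSpace.single i (1 : ℝ) + b • EuclideanSpace.single j (1 : ℝ),
      l e • EuclideanSpace.single i (1 : ℝ) + m e • EuclideanSpace.single j (1 : ℝ), ?_, ?_⟩
    · intro hv
      have := congrArg (fun p : E 2 => p i) hv
      simp [hij] at this
      exact he this
    · intro t
      have hlim2 := ((d1 (t • e)).smul_const (EuclideanSpace.single i (1 : ℝ))).add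
        ((d2 (t • e)).smul_const (EuclideanSpace.single j (1 : ℝ)))
      have : a • EuclideanSpace.single i (1 : ℝ) + b • EuclideanSpace.single j (1 : ℝ) +
          t • (l e • EuclideanSpace.single i (1 : ℝ) + m e • EuclideanSpace.single j (1 : ℝ))
          = (a + l (t • e)) • EuclideanSpace.single i (1 : ℝ)
          + (b + m (t • e)) • EuclideanSpace.single j (1 : ℝ) := by
        simp only [map_smul, smul_eq_mul]
        module
      rw [this]
      refine mem_closure_of_tendsto hlim2 ?_
      filter_upwards [hRφ.eventually_gt_atTop ‖t • e‖] with k hk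
      rw [← hrep]
      exact (hF (φ k)).2.1 (by rw [mem_ball, dist_zero_right]; exact hk)
  · right
    push Not at hA
    have hA : ∀ K' : ℝ, ∀ᶠ k in atTop, K' < |F k 0 j| := fun K' => by
      simpa [not_frequently] using hA K'
    have main : ∀ t N : ℝ, ∀ᶠ k in atTop, ∃ p ∈ ω, p i = t ∧
        ((0 ≤ F k 0 j ∧ N ≤ p j) ∨ (F k 0 j < 0 ∧ p j ≤ -N)) := by
      intro t N
      set ρ : ℝ := 2 * (4 * C + |t| + 2) with hρ
      have hρ0 : 0 < ρ := by have := abs_nonneg t; linarith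
      have hev1 : ∀ᶠ k : ℕ in atTop, C * (((k : ℝ) + 10) + 4 * C) * ρ ^ 2 / ((k : ℝ) + 10) ^ 2 ≤ 1 := by
        have hinv : Tendsto (fun k : ℕ => ((k : ℝ) + 10)⁻¹) atTop (𝓝 0) :=
          tendsto_inv_atTop_zero.comp hR
        have h1 : Tendsto (fun k : ℕ => C * ρ ^ 2 * (((k : ℝ) + 10)⁻¹
            + 4 * C * ((k : ℝ) + 10)⁻¹ ^ 2)) atTop (𝓝 0) := by
          have := (hinv.add ((hinv.pow 2).const_mul (4 * C))).const_mul (C * ρ ^ 2)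
          simpa using this
        filter_upwards [h1.eventually_le_const zero_lt_one] with k hk
        refine le_trans (le_of_eq ?_) hk
        have : (0 : ℝ) < (k : ℝ) + 10 := by have := hR10 k; linarith
        field_simp
      filter_upwards [hev1, hA (C * (ρ + |N| + 1)), hR.eventually_ge_atTop (40 * ρ)]
        with k h1 h2 h3
      have hk10 := hR10 k
      have hsub : closedBall (0 : E n) ρ ⊆ ball 0 ((k : ℝ) + 10) := by
        apply closedBall_subset_ball; linarith
      have hcont : ∀ l, ContinuousOn (fun x => F k x l) (closedBall (0 : E n) ρ) := fun l =>
        (((hF k).1 l).1.continuousOn).mono hsub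
      have hpre : IsPreconnected (closedBall (0 : E n) ρ) := (convex_closedBall 0 ρ).isPreconnected
      have h0m : (0 : E n) ∈ closedBall (0 : E n) ρ := by simp [hρ0.le]
      -- find e
      obtain ⟨e, he1, he2⟩ : ∃ e : E n, ‖e‖ < 1 ∧ 1 / 2 < fderiv ℝ (fun x => F k x i) 0 e := by
        obtain ⟨e, he1, he2⟩ := ContinuousLinearMap.exists_lt_apply_of_lt_opNorm
          (fderiv ℝ (fun x => F k x i) 0) (r := 1 / 2) (by have := hl1 k; linarith)
        rw [Real.norm_eq_abs, lt_abs] at he2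
        rcases he2 with he2 | he2
        · exact ⟨e, he1, he2⟩
        · exact ⟨-e, by simpa using he1, by simpa using he2⟩
      have herr : ∀ x ∈ closedBall (0 : E n) ρ,
          |F k x i - F k 0 i - fderiv ℝ (fun x => F k x i) 0 x| ≤ 1 := by
        intro x hx
        rw [mem_closedBall, dist_zero_right] at hx
        refine ((hB i k).2.1 x (by linarith)).trans (le_trans ?_ h1)
        have := hu0 k
        gcongr
      have hm1 : ρ • e ∈ closedBall (0 : E n) ρ := by
        rw [mem_closedBall, dist_zero_right, norm_smul, Real.norm_of_nonneg hρ0.le]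
        nlinarith
      have hm2 : (-ρ) • e ∈ closedBall (0 : E n) ρ := by
        rw [neg_smul]; simpa using hm1
      have g1 := abs_le.1 (herr _ hm1)
      have g2 := abs_le.1 (herr _ hm2)
      rw [map_smul, smul_eq_mul] at g1 g2
      have g3 := abs_le.1 (hu0 k)
      have g4 : ρ * (1 / 2) ≤ ρ * fderiv ℝ (fun x => F k x i) 0 e := by gcongr
      have g5 := le_abs_self t
      have g6 := neg_abs_le t
      obtain ⟨x, hx, hxt⟩ := hpre.intermediate_value hm2 hm1 (hcont i)
        (show t ∈ Set.Icc _ _ from ⟨by linarith [g2.2], by linarith [g1.1]⟩)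
      have hvb : ∀ y ∈ closedBall (0 : E n) ρ, |N| + 1 ≤ |F k y j| := by
        intro y hy
        rw [mem_closedBall, dist_zero_right] at hy
        have q := (hB j k).2.2 y (by linarith)
        have q2 : C * (ρ + |N| + 1) < C * (‖y‖ + |F k y j|) := h2.trans_le q
        have := lt_of_mul_lt_mul_left q2 (by linarith)
        linarith
      have hN := le_abs_self N
      have hNn := abs_nonneg N
      have hx' := hvb x hx
      refine ⟨F k x, (hF k).2.1 (hsub hx), hxt, ?_⟩
      rcases le_or_gt 0 (F k 0 j) with hs | hs
      · left
        refine ⟨hs, ?_⟩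
        by_contra hc
        push Not at hc
        have hneg : F k x j ≤ 0 := by
          by_contra hp
          push Not at hp
          rw [abs_of_pos hp] at hx'
          linarith
        obtain ⟨y, hy, hy0⟩ := hpre.intermediate_value hx h0m (hcont j)
          (show (0 : ℝ) ∈ Set.Icc _ _ from ⟨hneg, hs⟩)
        have := hvb y hy
        simp only at hy0
        rw [hy0, abs_zero] at this
        linarith
      · right
        refine ⟨hs, ?_⟩
        by_contra hc
        push Not at hc
        have hpos : 0 ≤ F k x j := by
          by_contra hp
          push Not at hp
          rw [abs_of_neg hp] at hx'
          linarith
        obtain ⟨y, hy, hy0⟩ := hpre.intermediate_value h0m hx (hcont j)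
          (show (0 : ℝ) ∈ Set.Icc _ _ from ⟨hs.le, hpos⟩)
        have := hvb y hy
        simp only at hy0
        rw [hy0, abs_zero] at this
        linarith
    by_cases hfr : ∃ᶠ k in atTop, 0 ≤ F k 0 j
    · left
      intro t N
      obtain ⟨k, hk, p, hp, hpt, hc⟩ := (hfr.and_eventually (main t N)).exists
      refine ⟨p, hp, hpt, ?_⟩
      rcases hc with hc | hc
      · exact hc.2
      · linarith [hc.1]
    · right
      rw [not_frequently] at hfr
      intro t N
      obtain ⟨k, hk, p, hp, hpt, hc⟩ := (hfr.and (main t N)).exists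
      refine ⟨p, hp, hpt, ?_⟩
      rcases hc with hc | hc
      · exact absurd hc.1 hk
      · exact hc.2

lemma pt_eta (p : E 2) : pt (p 0) (p 1) = p := by
  ext l
  fin_cases l <;> rfl

/-- **Geometry of non-`n`-hyperbolic plane domains.** A domain `ω ⊆ ℝ²` which is not
`n`-hyperbolic has at least one of the properties: its closure contains an affine line, or
for every `t ∈ ℝ` there is a sequence of points of `ω` with one coordinate tending to `±∞`
and the other tending to `t`. -/
theorem stmt18 (ω : Set (E 2)) (hωo : IsOpen ω) (hωc : IsConnected ω)
    (n : ℕ) (hn : 1 ≤ n) (hnh : ¬ NHyp n ω) :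
    (∃ a v : E 2, v ≠ 0 ∧ ∀ t : ℝ, a + t • v ∈ closure ω) ∨
    (∀ t : ℝ, ∃ s : ℕ → ℝ × ℝ, (∀ k, pt (s k).1 (s k).2 ∈ ω) ∧
      Tendsto (fun k => (s k).1) atTop atTop ∧ Tendsto (fun k => (s k).2) atTop (𝓝 t)) ∨
    (∀ t : ℝ, ∃ s : ℕ → ℝ × ℝ, (∀ k, pt (s k).1 (s k).2 ∈ ω) ∧
      Tendsto (fun k => (s k).1) atTop atBot ∧ Tendsto (fun k => (s k).2) atTop (𝓝 t)) ∨
    (∀ t : ℝ, ∃ s : ℕ → ℝ × ℝ, (∀ k, pt (s k).1 (s k).2 ∈ ω) ∧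
      Tendsto (fun k => (s k).2) atTop atTop ∧ Tendsto (fun k => (s k).1) atTop (𝓝 t)) ∨
    (∀ t : ℝ, ∃ s : ℕ → ℝ × ℝ, (∀ k, pt (s k).1 (s k).2 ∈ ω) ∧
      Tendsto (fun k => (s k).2) atTop atBot ∧ Tendsto (fun k => (s k).1) atTop (𝓝 t)) := by
  have hbot : Tendsto (fun k : ℕ => -(k : ℝ)) atTop atBot :=
    tendsto_neg_atTop_atBot.comp tendsto_natCast_atTop_atTop
  obtain ⟨i, hi⟩ := good_index hnh
  have hcases : i = 0 ∨ i = 1 := by omega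
  rcases hcases with rfl | rfl
  · rcases core 0 1 (by decide) hi with h | h | h
    · exact Or.inl h
    · right; right; right; left
      intro t
      choose p hp hpt hpN using fun k : ℕ => h t k
      refine ⟨fun k => (p k 0, p k 1), fun k => by simpa only [pt_eta] using hp k, ?_, ?_⟩
      · exact tendsto_atTop_mono hpN tendsto_natCast_atTop_atTop
      · simp only [hpt]; exact tendsto_const_nhds
    · right; right; right; right
      intro t
      choose p hp hpt hpN using fun k : ℕ => h t k
      refine ⟨fun k => (p k 0, p k 1), fun k => by simpa only [pt_eta] using hp k, ?_, ?_⟩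
      · exact tendsto_atBot_mono hpN hbot
      · simp only [hpt]; exact tendsto_const_nhds
  · rcases core 1 0 (by decide) hi with h | h | h
    · exact Or.inl h
    · right; left
      intro t
      choose p hp hpt hpN using fun k : ℕ => h t k
      refine ⟨fun k => (p k 0, p k 1), fun k => by simpa only [pt_eta] using hp k, ?_, ?_⟩
      · exact tendsto_atTop_mono hpN tendsto_natCast_atTop_atTop
      · simp only [hpt]; exact tendsto_const_nhds
    · right; right; left
      intro t
      choose p hp hpt hpN using fun k : ℕ => h t k
      refine ⟨fun k => (p k 0, p k 1), fun k => by simpa only [pt_eta] using hp k, ?_, ?_⟩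
      · exact tendsto_atBot_mono hpN hbot
      · simp only [hpt]; exact tendsto_const_nhds
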